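/- arXiv:2106.01930 — 6 statements merged into one kernel-verified Lean document; each statement's English description precedes it below -/
import Mathlib

section
/- Let a, b ∈ (Rmax)^n, both different from ⊥, such that supp a ∩ supp b ≠ ∅, and let r ≥ 0. Then dist_H(B(a,r), H_b) ≥ r. -/
open scoped Classical BigOperators

noncomputable section

namespace TropReg

/-- `x` is a vector of `Rmax = ℝ ∪ {-∞}`, modeled inside `EReal` as having no `+∞` entry. -/
def IsRmax {n : ℕ} (x : Fin n → EReal) : Prop := ∀ i, x i ≠ ⊤

/-- Embedding of a real vector into `(Rmax)^n`. -/
def ofReal {n : ℕ} (a : Fin n → ℝ) : Fin n → EReal := fun i => (a i : EReal)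

/-- Hilbert's projective metric on `(Rmax)^n`, with values in `[0,+∞] ⊆ EReal`;
`d(⊥,⊥) = 0` by convention, and the infimum of the empty set is `+∞`. -/
def hd {n : ℕ} (x y : Fin n → EReal) : EReal :=
  if x = ⊥ ∧ y = ⊥ then 0
  else sInf { t : EReal | ∃ lam mu : ℝ, t = (lam : EReal) - (mu : EReal) ∧
        (∀ i, (mu : EReal) + y i ≤ x i) ∧ (∀ i, x i ≤ (lam : EReal) + y i) }

/-- Closed Hilbert ball of center `a` and radius `r`, inside `(Rmax)^n`. -/
def ball {n : ℕ} (a : Fin n → EReal) (r : EReal) : Set (Fin n → EReal) :=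
  { x | IsRmax x ∧ hd a x ≤ r }

/-- Hilbert distance from a point to a set. -/
def distPt {n : ℕ} (x : Fin n → EReal) (B : Set (Fin n → EReal)) : EReal :=
  ⨅ b ∈ B, hd x b

/-- One-sided Hausdorff distance from `A` to `B` for Hilbert's metric. -/
def distHS {n : ℕ} (A B : Set (Fin n → EReal)) : EReal :=
  ⨆ a ∈ A, distPt a B

/-- Tropical hyperplane associated with `a`: the maximum `max_i (a_i + x_i)` is
attained at least twice. -/
def hyper {n : ℕ} (a : Fin n → EReal) : Set (Fin n → EReal) :=
  { x | IsRmax x ∧ ∃ i j : Fin n, i ≠ j ∧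
      a i + x i = (⨆ k, a k + x k) ∧ a j + x j = (⨆ k, a k + x k) }

/-- Tropical column space of the matrix `V`. -/
def colSpace {n p : ℕ} (V : Fin n → Fin p → EReal) : Set (Fin n → EReal) :=
  { y | ∃ x : Fin p → EReal, IsRmax x ∧ y = fun i => ⨆ k, (V i k + x k) }

/-- The `k`-th column of `V`. -/
def col {n p : ℕ} (V : Fin n → Fin p → EReal) (k : Fin p) : Fin n → EReal :=
  fun i => V i k

/-- The set of columns of `V`. -/
def cols {n p : ℕ} (V : Fin n → Fin p → EReal) : Set (Fin n → EReal) :=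
  Set.range (col V)

/-- The Shapley operator associated with the matrix `V`. -/
def TV {n p : ℕ} (V : Fin n → Fin p → EReal) (x : Fin n → EReal) : Fin n → EReal :=
  fun i => ⨅ k ∈ { k : Fin p | V i k ≠ ⊥ },
    (-(V i k) + ⨆ j ∈ { j : Fin n | j ≠ i }, (V j k + x j))

/-- Tropical spectral radius of an operator `T`. -/
def rho {n : ℕ} (T : (Fin n → EReal) → (Fin n → EReal)) : EReal :=
  sSup { lam : EReal | lam ≠ ⊤ ∧ ∃ u : Fin n → EReal, IsRmax u ∧ u ≠ ⊥ ∧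
      T u = fun i => lam + u i }

/-- Tropical convex cone in `(Rmax)^n`. -/
def IsTropCone {n : ℕ} (C : Set (Fin n → EReal)) : Prop :=
  (∀ x ∈ C, ∀ y ∈ C, (fun i => x i ⊔ y i) ∈ C) ∧
  (∀ x ∈ C, ∀ lam : EReal, lam ≠ ⊤ → (fun i => lam + x i) ∈ C)

/-- Tropical span: smallest tropical cone containing `Vs`. -/
def span {n : ℕ} (Vs : Set (Fin n → EReal)) : Set (Fin n → EReal) :=
  ⋂₀ { C | IsTropCone C ∧ Vs ⊆ C }

/-- Inner radius: supremum of radii of Hilbert balls centered at finite points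
included in `W`. -/
def inradius {n : ℕ} (W : Set (Fin n → EReal)) : EReal :=
  sSup { r : EReal | ∃ s : ℝ, r = (s : EReal) ∧ 0 ≤ s ∧
      ∃ a : Fin n → ℝ, ball (ofReal a) r ⊆ W }


/-- Raising the coordinate `k` of `a` by `r` moves it by at most `r` in Hilbert's metric. -/
theorem hd_update_add_le {n : ℕ} {a : Fin n → EReal} (hab : a ≠ ⊥) (k : Fin n)
    {r : ℝ} (hr : 0 ≤ r) : hd a (Function.update a k (a k + r)) ≤ r := by
  have hr' : (0 : EReal) ≤ (r : EReal) := by exact_mod_cast hr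
  rw [hd, if_neg (fun h => hab h.1)]
  refine sInf_le ⟨0, -r, ?_, fun i => ?_, fun i => ?_⟩
  · rw [← EReal.coe_sub]
    simp
  · rcases eq_or_ne i k with rfl | hi
    · rw [Function.update_self, add_left_comm, ← EReal.coe_add]
      simp
    · rw [Function.update_of_ne hi]
      calc ((-r : ℝ) : EReal) + a i ≤ ((0 : ℝ) : EReal) + a i := by
            gcongr
            exact_mod_cast neg_nonpos.mpr hr
        _ = a i := by simp
  · rcases eq_or_ne i k with rfl | hi
    · rw [Function.update_self]
      simpa using add_le_add_right hr' (a i)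
    · simp [Function.update_of_ne hi]

/-- If `b k + a k` is real and dominates every `b i + a i`, then raising the coordinate `k` of `a`
by `r` yields a point at Hilbert distance at least `r` from the hyperplane of `b`. -/
theorem le_distPt_update_add_hyper {n : ℕ} {a b : Fin n → EReal} {k : Fin n} {c : ℝ}
    (hk : b k + a k = c) (hmax : ∀ i, b i + a i ≤ c) (r : ℝ) (hak : a k ≠ ⊥) :
    (r : EReal) ≤ distPt (Function.update a k (a k + r)) (hyper b) := by
  refine le_iInf₂ fun y hy => ?_
  obtain ⟨-, i, j, hij, hi, hj⟩ := hy
  obtain ⟨m, hmk, hm⟩ : ∃ m, m ≠ k ∧ b m + y m = ⨆ l, b l + y l := by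
    rcases eq_or_ne i k with rfl | hik
    · exact ⟨j, hij.symm, hj⟩
    · exact ⟨i, hik, hi⟩
  have hx : Function.update a k (a k + r) ≠ ⊥ := fun h => by
    have := congrFun h k
    simp [EReal.add_eq_bot_iff, hak] at this
  rw [hd, if_neg (fun h => hx h.1)]
  refine le_sInf ?_
  rintro _ ⟨lam, mu, rfl, hlow, hup⟩
  have h₁ : ((c + r : ℝ) : EReal) ≤ lam + (b m + y m) := by
    calc ((c + r : ℝ) : EReal) = b k + (a k + r) := by rw [EReal.coe_add, ← hk, add_assoc]
      _ ≤ b k + (lam + y k) := by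
          refine add_le_add le_rfl ?_
          simpa using hup k
      _ = lam + (b k + y k) := add_left_comm _ _ _
      _ ≤ lam + (b m + y m) := by
          refine add_le_add le_rfl ?_
          rw [hm]
          exact le_iSup (fun l => b l + y l) k
  have h₂ : (mu : EReal) + (b m + y m) ≤ c := by
    calc (mu : EReal) + (b m + y m) = b m + (mu + y m) := add_left_comm _ _ _
      _ ≤ b m + a m := by
          gcongr
          simpa [Function.update_of_ne hmk] using hlow m
      _ ≤ c := hmax m
  generalize b m + y m = z at h₁ h₂
  induction z with
  | bot => simp [-EReal.coe_add] at h₁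
  | top => simp at h₂
  | coe z =>
    norm_cast at h₁ h₂ ⊢
    linarith

/-- If `a, b ∈ (Rmax)^n` are different from `⊥` and have
non-disjoint supports, then for all `r ≥ 0` the Hilbert distance from the ball
`B(a,r)` to the tropical hyperplane `H_b` is at least `r`. -/
theorem stmt9 {n : ℕ} (a b : Fin n → EReal) (ha : IsRmax a) (hb : IsRmax b)
    (hab : a ≠ ⊥) (hbb : b ≠ ⊥)
    (hsupp : ∃ i, a i ≠ ⊥ ∧ b i ≠ ⊥)
    (r : ℝ) (hr : 0 ≤ r) :
    (r : EReal) ≤ distHS (ball a (r : EReal)) (hyper b) := by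
  obtain ⟨i₀, hai, hbi⟩ := hsupp
  obtain ⟨k, -, hk⟩ := Finset.exists_max_image Finset.univ (fun i => b i + a i)
    ⟨i₀, Finset.mem_univ i₀⟩
  have hbot : b k + a k ≠ ⊥ := fun h => by
    have := hk i₀ (Finset.mem_univ i₀)
    simp [h, EReal.add_eq_bot_iff, hai, hbi] at this
  have hak : a k ≠ ⊥ := fun h => hbot (by simp [h])
  lift b k + a k to ℝ using ⟨EReal.add_ne_top (hb k) (ha k), hbot⟩ with c hc
  have hx : IsRmax (Function.update a k (a k + r)) := fun i => by
    rcases eq_or_ne i k with rfl | hi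
    · simpa using EReal.add_ne_top (ha i) (EReal.coe_ne_top r)
    · simpa [Function.update_of_ne hi] using ha i
  exact (le_distPt_update_add_hyper hc.symm (fun i => hk i (Finset.mem_univ i)) r hak).trans
    (le_iSup₂ (f := fun x (_ : x ∈ ball a (r : EReal)) => distPt x (hyper b))
      _ ⟨hx, hd_update_add_le hab k hr⟩)

end TropReg
end
end

section
/- Let 𝒱 ⊆ (Rmax)^n be any subset and let W ⊆ (Rmax)^n be a nonempty tropical cone. Then dist_H(Sp(𝒱), W) = dist_H(𝒱, W). -/
open scoped Classical BigOperators

noncomputable section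

namespace TropReg

/-- Vectors lying between some `w ∈ W` and its translate `t + w`. -/
def slab {n : ℕ} (W : Set (Fin n → EReal)) (t : ℝ) : Set (Fin n → EReal) :=
  { x | ∃ w ∈ W, ∀ i, w i ≤ x i ∧ x i ≤ (t : EReal) + w i }

lemma isTropCone_slab {n : ℕ} {W : Set (Fin n → EReal)} (hW : IsTropCone W) (t : ℝ) :
    IsTropCone (slab W t) := by
  constructor
  · rintro x ⟨u, hu, hux⟩ y ⟨w, hw, hwy⟩
    refine ⟨_, hW.1 u hu w hw, fun i => ⟨sup_le_sup (hux i).1 (hwy i).1, sup_le ?_ ?_⟩⟩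
    · exact (hux i).2.trans (by gcongr; exact le_sup_left)
    · exact (hwy i).2.trans (by gcongr; exact le_sup_right)
  · rintro x ⟨w, hw, hwx⟩ lam hlam
    refine ⟨_, hW.2 w hw lam hlam, fun i => ⟨?_, ?_⟩⟩
    · have := (hwx i).1
      dsimp only
      gcongr
    · dsimp only
      rw [add_left_comm]
      have := (hwx i).2
      gcongr

lemma hd_nonneg {n : ℕ} {x y : Fin n → EReal} (hy : IsRmax y) : 0 ≤ hd x y := by
  unfold hd
  split_ifs with h
  · exact le_rfl
  refine le_sInf ?_
  rintro _ ⟨lam, mu, rfl, h1, h2⟩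
  by_cases hyb : ∃ i, y i ≠ ⊥
  · obtain ⟨i, hi⟩ := hyb
    have h3 := (h1 i).trans (h2 i)
    lift y i to ℝ using ⟨hy i, hi⟩ with r
    norm_cast at h3 ⊢
    linarith
  · push Not at hyb
    refine absurd ⟨?_, funext hyb⟩ h
    funext i
    simpa [hyb i] using h2 i

lemma mem_slab_of_distPt_lt {n : ℕ} {W : Set (Fin n → EReal)} (hW : IsTropCone W)
    {x : Fin n → EReal} {t : ℝ} (h : distPt x W < t) : x ∈ slab W t := by
  simp only [distPt, iInf_lt_iff] at h
  obtain ⟨w, hw, h⟩ := h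
  unfold hd at h
  split_ifs at h with hb
  · exact ⟨w, hw, fun i => by simp [hb.1, hb.2]⟩
  obtain ⟨_, ⟨lam, mu, rfl, h1, h2⟩, hlt⟩ := sInf_lt_iff.1 h
  refine ⟨_, hW.2 w hw mu (EReal.coe_ne_top mu), fun i => ⟨h1 i, (h2 i).trans ?_⟩⟩
  rw [← add_assoc]
  gcongr
  norm_cast at hlt ⊢
  linarith

lemma distPt_le_of_mem_slab {n : ℕ} {W : Set (Fin n → EReal)} {x : Fin n → EReal} {t : ℝ}
    (ht : 0 ≤ t) (h : x ∈ slab W t) : distPt x W ≤ t := by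
  obtain ⟨w, hw, h⟩ := h
  refine (iInf₂_le w hw).trans ?_
  unfold hd
  split_ifs
  · exact_mod_cast ht
  · exact sInf_le ⟨t, 0, by simp, fun i => by simpa using (h i).1, fun i => (h i).2⟩

lemma subset_span {n : ℕ} (Vs : Set (Fin n → EReal)) : Vs ⊆ span Vs :=
  Set.subset_sInter fun _ hC => hC.2

lemma span_subset {n : ℕ} {Vs C : Set (Fin n → EReal)} (hC : IsTropCone C) (h : Vs ⊆ C) :
    span Vs ⊆ C :=
  Set.sInter_subset_of_mem ⟨hC, h⟩

/-- For any subset `𝒱` of `(Rmax)^n` and any nonempty tropical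
cone `W ⊆ (Rmax)^n`, one has `dist_H(Sp(𝒱), W) = dist_H(𝒱, W)`. -/
theorem stmt10 {n : ℕ} (Vs W : Set (Fin n → EReal))
    (hVs : ∀ v ∈ Vs, IsRmax v)
    (hW : IsTropCone W) (hWRmax : ∀ w ∈ W, IsRmax w) (hWne : W.Nonempty) :
    distHS (span Vs) W = distHS Vs W := by
  refine le_antisymm ?_ (biSup_mono fun v hv => subset_span Vs hv)
  rcases Vs.eq_empty_or_nonempty with rfl | ⟨v, hv⟩
  · have : span (∅ : Set (Fin n → EReal)) ⊆ ∅ := span_subset (by simp [IsTropCone]) le_rfl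
    exact biSup_mono fun v hv => this hv
  have hD : 0 ≤ distHS Vs W :=
    (le_iInf₂ fun w hw => hd_nonneg (hWRmax w hw)).trans
      (le_iSup₂ (f := fun a (_ : a ∈ Vs) => distPt a W) v hv)
  refine EReal.le_of_forall_lt_iff_le.1 fun t ht => iSup₂_le fun x hx => ?_
  refine distPt_le_of_mem_slab (by exact_mod_cast hD.trans ht.le)
    (span_subset (isTropCone_slab hW t) (fun u hu => ?_) hx)
  exact mem_slab_of_distPt_lt hW
    ((le_iSup₂ (f := fun a (_ : a ∈ Vs) => distPt a W) u hu).trans_lt ht)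

end TropReg
end
end

section
/- Let 𝒱 be a finite set of vectors of (Rmax)^n, each different from ⊥. Then sup{r ≥ 0 : ∃ a ∈ R^n, B(a,r) ⊆ Sp(𝒱)} ≤ inf over all b ∈ (Rmax)^n with b ≠ ⊥ of dist_H(𝒱, H_b) (weak duality between inner Hilbert balls of Sp(𝒱) and tropical hyperplane approximation of 𝒱). -/
open scoped Classical BigOperators

noncomputable section

namespace TropReg

/-- A vector of the span whose `i`-th entry is not `-∞` dominates a finite translate of some
generator, with equality at the coordinate `i`. -/
theorem exists_translate_le_of_mem_span {n : ℕ} {Vs : Set (Fin n → EReal)}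
    {z : Fin n → EReal} (hz : z ∈ span Vs) (i : Fin n) (hzi : z i ≠ ⊥) :
    ∃ v ∈ Vs, ∃ c : ℝ, (c : EReal) + v i = z i ∧ ∀ j, (c : EReal) + v j ≤ z j := by
  let C : Set (Fin n → EReal) := {z | z i = ⊥ ∨
    ∃ v ∈ Vs, ∃ c : ℝ, (c : EReal) + v i = z i ∧ ∀ j, (c : EReal) + v j ≤ z j}
  have hC : IsTropCone C := by
    refine ⟨fun x hx y hy => ?_, fun x hx lam hlam => ?_⟩
    · rcases le_total (x i) (y i) with h | h
      · rcases hy with hy | ⟨v, hv, c, hci, hc⟩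
        · left
          simpa [hy] using h
        · right
          exact ⟨v, hv, c, by simpa [h] using hci, fun j => (hc j).trans le_sup_right⟩
      · rcases hx with hx | ⟨v, hv, c, hci, hc⟩
        · left
          simpa [hx] using h
        · right
          exact ⟨v, hv, c, by simpa [h] using hci, fun j => (hc j).trans le_sup_left⟩
    · induction lam with
      | bot => left; simp
      | top => exact absurd rfl hlam
      | coe t =>
        rcases hx with hx | ⟨v, hv, c, hci, hc⟩
        · left
          simp [hx]
        · right
          refine ⟨v, hv, t + c, ?_, fun j => ?_⟩
          · simp only [EReal.coe_add, add_assoc, hci]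
          · simp only [EReal.coe_add, add_assoc]
            exact add_le_add_right (hc j) _
  have hVC : Vs ⊆ C := fun v hv => Or.inr ⟨v, hv, 0, by simp, fun j => by simp⟩
  have hzC : z ∈ C := hz C ⟨hC, hVC⟩
  exact hzC.resolve_left hzi

/-- Raising one entry of a real vector by `s ≥ 0` stays in the Hilbert ball of radius `s`. -/
theorem ofReal_update_mem_ball {n : ℕ} (a : Fin n → ℝ) {s : ℝ} (hs : 0 ≤ s) (i : Fin n) :
    ofReal (Function.update a i (a i + s)) ∈ ball (ofReal a) (s : EReal) := by
  refine ⟨fun j => EReal.coe_ne_top _, ?_⟩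
  have hbot : ¬ (ofReal a = ⊥ ∧ ofReal (Function.update a i (a i + s)) = ⊥) :=
    fun h => EReal.coe_ne_bot (a i) (congrFun h.1 i)
  rw [hd, if_neg hbot]
  refine sInf_le ⟨0, -s, by simp, fun j => ?_, fun j => ?_⟩
  · simp only [ofReal]
    rw [← EReal.coe_add, EReal.coe_le_coe_iff]
    rcases eq_or_ne j i with rfl | h
    · simp
    · simp [h, hs]
  · simp only [ofReal]
    rw [← EReal.coe_add, EReal.coe_le_coe_iff]
    rcases eq_or_ne j i with rfl | h
    · simp [hs]
    · simp [h]

/-- A vector of a tropical hyperplane cannot have a single strictly dominant coordinate. -/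
theorem not_mem_hyper_of_forall_lt {n : ℕ} {b y : Fin n → EReal} (i : Fin n)
    (h : ∀ j, j ≠ i → b j + y j < b i + y i) : y ∉ hyper b := by
  rintro ⟨-, j, k, hjk, hj, hk⟩
  have hle : b i + y i ≤ ⨆ l, b l + y l := le_iSup (fun l => b l + y l) i
  rcases eq_or_ne j i with rfl | hji
  · exact absurd (hk ▸ hle) (h k hjk.symm).not_ge
  · exact absurd (hj ▸ hle) (h j hji).not_ge

/-- If `b i + v i` exceeds every other `b j + v j` by at least `s`, then `v` is at Hilbert
distance at least `s` from the hyperplane `H_b`. -/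
theorem le_distPt_hyper {n : ℕ} {b v : Fin n → EReal} {s : ℝ} (i : Fin n)
    (hb : IsRmax b) (hv : IsRmax v) (hbi : b i ≠ ⊥) (hvi : v i ≠ ⊥)
    (h : ∀ j, j ≠ i → (s : EReal) + (b j + v j) ≤ b i + v i) :
    (s : EReal) ≤ distPt v (hyper b) := by
  refine le_iInf₂ fun y hy => ?_
  have hbot : ¬ (v = ⊥ ∧ y = ⊥) := fun h' => hvi (congrFun h'.1 i)
  rw [hd, if_neg hbot]
  refine le_sInf ?_
  rintro _ ⟨lam, mu, rfl, hmu, hlam⟩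
  by_contra! hlt
  rw [← EReal.coe_sub, EReal.coe_lt_coe_iff] at hlt
  refine not_mem_hyper_of_forall_lt i (fun j hj => ?_) hy
  have hyi : y i ≠ ⊥ := by
    intro h0
    have := hlam i
    simp [h0, hvi] at this
  have hlami := hlam i
  have hmuj := hmu j
  have hij := h j hj
  have hyi' := hy.1 i
  have hyj' := hy.1 j
  have hbi' := hb i
  have hbj' := hb j
  have hvi' := hv i
  have hvj' := hv j
  lift b i to ℝ using ⟨hbi', hbi⟩ with β
  lift v i to ℝ using ⟨hvi', hvi⟩ with ν
  lift y i to ℝ using ⟨hyi', hyi⟩ with η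
  by_cases hbj : b j = ⊥
  · rw [hbj, EReal.bot_add, ← EReal.coe_add]
    exact EReal.bot_lt_coe _
  by_cases hyj : y j = ⊥
  · rw [hyj, EReal.add_bot, ← EReal.coe_add]
    exact EReal.bot_lt_coe _
  lift y j to ℝ using ⟨hyj', hyj⟩ with η'
  lift b j to ℝ using ⟨hbj', hbj⟩ with β'
  have hvj : v j ≠ ⊥ := by
    intro h0
    rw [h0, ← EReal.coe_add, le_bot_iff] at hmuj
    exact EReal.coe_ne_bot _ hmuj
  lift v j to ℝ using ⟨hvj', hvj⟩ with ν'
  norm_cast at *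
  linarith

/-- **weak duality.** For a finite set `𝒱` of vectors of `(Rmax)^n`,
each different from `⊥`, the supremum of radii of Hilbert balls centered at finite
points contained in `Sp(𝒱)` is at most the infimum over all tropical hyperplanes
`H_b` of `dist_H(𝒱, H_b)`. -/
theorem stmt11 {n : ℕ} (Vs : Set (Fin n → EReal)) (hfin : Vs.Finite)
    (hVs : ∀ v ∈ Vs, IsRmax v) (hne : ∀ v ∈ Vs, v ≠ ⊥) :
    sSup { r : EReal | ∃ s : ℝ, r = (s : EReal) ∧ 0 ≤ s ∧
        ∃ a : Fin n → ℝ, ball (ofReal a) r ⊆ span Vs } ≤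
      ⨅ b ∈ { b : Fin n → EReal | IsRmax b ∧ b ≠ ⊥ }, distHS Vs (hyper b) := by
  refine sSup_le ?_
  rintro _ ⟨s, rfl, hs, a, ha⟩
  refine le_iInf₂ fun b hb => ?_
  obtain ⟨hbR, hb0⟩ := hb
  obtain ⟨k, hk⟩ : ∃ k, b k ≠ ⊥ := Function.ne_iff.mp hb0
  have : Nonempty (Fin n) := ⟨k⟩
  obtain ⟨i, hi⟩ := Finite.exists_max fun j => b j + (a j : EReal)
  have hbi : b i ≠ ⊥ := by
    intro h0
    have := hi k
    simp [h0, hk] at this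
  obtain ⟨v, hv, c, hci, hc⟩ := exists_translate_le_of_mem_span
    (ha (ofReal_update_mem_ball a hs i)) i (EReal.coe_ne_bot _)
  have hvi : v i ≠ ⊥ := by
    intro h0
    rw [h0, EReal.add_bot] at hci
    exact EReal.coe_ne_bot _ hci.symm
  refine le_trans (le_distPt_hyper i hbR (hVs v hv) hbi hvi fun j hj => ?_)
    (le_iSup₂ (f := fun v (_ : v ∈ Vs) => distPt v (hyper b)) v hv)
  have hcj := hc j
  have hij := hi j
  have hbi' := hbR i
  have hbj' := hbR j
  have hvi' := hVs v hv i
  have hvj' := hVs v hv j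
  simp only [ofReal, Function.update_self] at hci
  simp only [ofReal, Function.update_of_ne hj] at hcj
  by_cases hbj : b j = ⊥
  · simp [hbj]
  by_cases hvj : v j = ⊥
  · simp [hvj]
  lift b i to ℝ using ⟨hbi', hbi⟩ with β
  lift v i to ℝ using ⟨hvi', hvi⟩ with ν
  lift b j to ℝ using ⟨hbj', hbj⟩ with β'
  lift v j to ℝ using ⟨hvj', hvj⟩ with ν'
  norm_cast at *
  linarith

end TropReg
end
end

section
/- For all λ ∈ [−∞, 0] and all b ∈ (Rmax)^n with b ≠ ⊥: T(b) ≥ λ + b (entrywise) if and only if dist_H(𝒱, H_b) ≤ −λ, where 𝒱 is the set of columns of V. -/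
open scoped Classical BigOperators

noncomputable section

namespace TropReg

/-- Real translations of `EReal` can be moved across an inequality. -/
lemma coe_add_le_iff (c : ℝ) (x s : EReal) :
    (c : EReal) + x ≤ s ↔ x ≤ -(c : EReal) + s := by
  rw [← EReal.coe_neg]
  induction x with
  | bot => simp
  | top => induction s <;> simp [← EReal.coe_add, -EReal.coe_neg]
  | coe x =>
    induction s with
    | bot => simp [← EReal.coe_add, -EReal.coe_neg]
    | top => simp [-EReal.coe_neg]
    | coe s =>
      norm_cast
      constructor <;> intro h <;> linarith

/-- Bounds `x ≤ e + s` for all real `e > r` pass to the limit `e = r`. -/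
lemma neg_add_le_of_forall_lt (r : ℝ) {x s : EReal}
    (h : ∀ e : ℝ, r < e → x ≤ (e : EReal) + s) : ((-r : ℝ) : EReal) + x ≤ s := by
  have h1 := h (r + 1) (by linarith)
  induction x with
  | bot => simp
  | top =>
    induction s with
    | bot => simp at h1
    | top => simp
    | coe s => norm_cast at h1
  | coe x =>
    induction s with
    | bot => simp at h1
    | top => simp
    | coe s =>
      norm_cast
      have : x - s ≤ r := le_of_forall_gt_imp_ge_of_dense fun e he => by
        have h2 := h e he
        norm_cast at h2
        linarith
      linarith

/-- A point of the hyperplane attains its maximum away from any given index. -/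
lemma le_iSup_ne_of_mem_hyper {n : ℕ} {b x : Fin n → EReal} (hx : x ∈ hyper b) (i : Fin n) :
    b i + x i ≤ ⨆ j ∈ {j : Fin n | j ≠ i}, (x j + b j) := by
  obtain ⟨-, j, k, hjk, hj, hk⟩ := hx
  obtain ⟨l, hl, hle⟩ : ∃ l, l ≠ i ∧ b l + x l = ⨆ k, b k + x k := by
    by_cases h : j = i
    · exact ⟨k, fun h' => hjk (h.trans h'.symm), hk⟩
    · exact ⟨j, h, hj⟩
  calc b i + x i ≤ b l + x l := hle ▸ le_iSup (fun k => b k + x k) i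
    _ = x l + b l := add_comm _ _
    _ ≤ _ := le_iSup₂_of_le l hl le_rfl

lemma hd_le {n : ℕ} {x y : Fin n → EReal} (hx : x ≠ ⊥) (s t : ℝ)
    (h1 : ∀ i, (t : EReal) + y i ≤ x i) (h2 : ∀ i, x i ≤ (s : EReal) + y i) :
    hd x y ≤ ((s - t : ℝ) : EReal) := by
  rw [hd, if_neg fun h => hx h.1]
  exact sInf_le ⟨s, t, EReal.coe_sub s t, h1, h2⟩

lemma neg_add_le_of_distPt_le {n : ℕ} {b v : Fin n → EReal} (hv : v ≠ ⊥) {r : ℝ}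
    (h : distPt v (hyper b) ≤ r) (i : Fin n) :
    ((-r : ℝ) : EReal) + (b i + v i) ≤ ⨆ j ∈ {j : Fin n | j ≠ i}, (v j + b j) := by
  refine neg_add_le_of_forall_lt r fun e he => ?_
  have h' : distPt v (hyper b) < e := h.trans_lt (by exact_mod_cast he)
  simp only [distPt, iInf_lt_iff] at h'
  obtain ⟨x, hx, hlt⟩ := h'
  rw [hd, if_neg fun h => hv h.1, sInf_lt_iff] at hlt
  obtain ⟨_, ⟨s, t, rfl, hl, hu⟩, hlt⟩ := hlt
  have hst : s - t ≤ e := by exact_mod_cast hlt.le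
  calc b i + v i ≤ b i + (s + x i) := by gcongr; exact hu i
    _ = s + (b i + x i) := add_left_comm _ _ _
    _ ≤ s + ⨆ j ∈ {j : Fin n | j ≠ i}, (x j + b j) := by
        gcongr; exact le_iSup_ne_of_mem_hyper hx i
    _ ≤ s + (-(t : EReal) + ⨆ j ∈ {j : Fin n | j ≠ i}, (v j + b j)) := by
        gcongr
        refine iSup₂_le fun j hj => ?_
        rw [← coe_add_le_iff, ← add_assoc]
        refine le_iSup₂_of_le j hj ?_
        gcongr
        exact hl j
    _ = ((s - t : ℝ) : EReal) + ⨆ j ∈ {j : Fin n | j ≠ i}, (v j + b j) := by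
        rw [← add_assoc, EReal.coe_sub, sub_eq_add_neg]
    _ ≤ _ := by gcongr

/-- Lowering the unique maximal entry of `v` to the second largest value reaches the
hyperplane. -/
lemma distPt_le_of_neg_add_le {n : ℕ} {b v : Fin n → EReal} (hb : IsRmax b) (hbb : b ≠ ⊥)
    (hvt : IsRmax v) (hv : v ≠ ⊥) {r : ℝ} (hr : 0 ≤ r)
    (h : ∀ i, ((-r : ℝ) : EReal) + (b i + v i) ≤ ⨆ j ∈ {j : Fin n | j ≠ i}, (v j + b j)) :
    distPt v (hyper b) ≤ r := by
  obtain ⟨i₀, hi₀⟩ : ∃ i, b i ≠ ⊥ := by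
    by_contra! hc; exact hbb (funext hc)
  have : Nonempty (Fin n) := ⟨i₀⟩
  obtain ⟨i, hi⟩ := Finite.exists_max fun k => b k + v k
  have hsup : ⨆ k, b k + v k = b i + v i := le_antisymm (iSup_le hi) (le_iSup (fun k => b k + v k) i)
  by_cases hbot : b i + v i = ⊥
  · have hall : ∀ k, b k + v k = ⊥ := fun k => le_bot_iff.1 (hbot ▸ hi k)
    have hvi₀ : v i₀ = ⊥ := (EReal.add_eq_bot_iff.1 (hall i₀)).resolve_left hi₀
    obtain ⟨j, hj⟩ : ∃ j, v j ≠ ⊥ := by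
      by_contra! hc; exact hv (funext hc)
    have hmem : v ∈ hyper b :=
      ⟨hvt, i₀, j, fun e => hj (e ▸ hvi₀), by rw [hsup, hbot, hall], by rw [hsup, hbot, hall]⟩
    refine (iInf₂_le v hmem).trans ((hd_le hv 0 0 (by simp) (by simp)).trans ?_)
    exact_mod_cast (by linarith : (0 : ℝ) - 0 ≤ r)
  · have hbi : b i ≠ ⊥ := fun e => hbot (by simp [e])
    have hvi : v i ≠ ⊥ := fun e => hbot (by simp [e])
    obtain ⟨β, hβ⟩ : ∃ β : ℝ, (β : EReal) = b i := ⟨_, EReal.coe_toReal (hb i) hbi⟩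
    obtain ⟨γ, hγ⟩ : ∃ γ : ℝ, (γ : EReal) = v i := ⟨_, EReal.coe_toReal (hvt i) hvi⟩
    have hS := h i
    rw [← hβ, ← hγ, ← EReal.coe_add, ← EReal.coe_add] at hS
    have hne : (Finset.univ.filter fun j : Fin n => j ≠ i).Nonempty := by
      by_contra hc
      rw [Finset.not_nonempty_iff_eq_empty, Finset.filter_eq_empty_iff] at hc
      have : (⨆ j ∈ {j : Fin n | j ≠ i}, (v j + b j)) ≤ ⊥ :=
        iSup₂_le fun j hj => (hc (Finset.mem_univ j) hj).elim
      exact EReal.coe_ne_bot _ (le_bot_iff.1 (hS.trans this))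
    obtain ⟨j, hj, hmax⟩ := Finset.exists_max_image _ (fun k => b k + v k) hne
    simp only [Finset.mem_filter, Finset.mem_univ, true_and] at hj hmax
    have hSj : ((-r + (β + γ) : ℝ) : EReal) ≤ b j + v j :=
      hS.trans (iSup₂_le fun k hk => (add_comm _ _).trans_le (hmax k hk))
    have hbj : b j + v j ≠ ⊥ := fun e => EReal.coe_ne_bot _ (le_bot_iff.1 (e ▸ hSj))
    obtain ⟨σ, hσ⟩ : ∃ σ : ℝ, (σ : EReal) = b j + v j := by
      refine ⟨_, EReal.coe_toReal (fun e => ?_) hbj⟩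
      have := hi j
      rw [e, ← hβ, ← hγ, ← EReal.coe_add] at this
      exact EReal.coe_ne_top _ (top_le_iff.1 this)
    have hle : σ ≤ β + γ := by
      have := hi j
      rw [← hσ, ← hβ, ← hγ] at this
      exact_mod_cast this
    have hge : -r + (β + γ) ≤ σ := by
      rw [← hσ] at hSj
      exact_mod_cast hSj
    let y : Fin n → EReal := Function.update v i ((σ - β : ℝ) : EReal)
    have hyi : y i = ((σ - β : ℝ) : EReal) := Function.update_self ..
    have hyk : ∀ k, k ≠ i → y k = v k := fun k hk => Function.update_of_ne hk ..
    have hbyi : b i + y i = σ := by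
      rw [hyi, ← hβ, ← EReal.coe_add]
      congr 1
      ring
    have hysup : ⨆ k, b k + y k = σ := by
      refine le_antisymm (iSup_le fun k => ?_) (hbyi ▸ le_iSup (fun k => b k + y k) i)
      by_cases hk : k = i
      · rw [hk, hbyi]
      · rw [hyk k hk, hσ]
        exact hmax k hk
    have hmem : y ∈ hyper b := by
      refine ⟨fun k => ?_, i, j, Ne.symm hj, by rw [hysup, hbyi], by rw [hysup, hyk j hj, hσ]⟩
      by_cases hk : k = i
      · rw [hk, hyi]
        exact EReal.coe_ne_top _
      · rw [hyk k hk]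
        exact hvt k
    refine (iInf₂_le y hmem).trans ((hd_le hv (β + γ - σ) 0 (fun k => ?_) fun k => ?_).trans ?_)
    · by_cases hk : k = i
      · rw [hk, hyi, ← hγ]
        exact_mod_cast (by linarith : 0 + (σ - β) ≤ γ)
      · simp [hyk k hk]
    · by_cases hk : k = i
      · rw [hk, hyi, ← hγ]
        exact_mod_cast (by linarith : γ ≤ β + γ - σ + (σ - β))
      · rw [hyk k hk]
        exact le_add_of_nonneg_left (by exact_mod_cast (by linarith : 0 ≤ β + γ - σ))
    · exact_mod_cast (by linarith : β + γ - σ - 0 ≤ r)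

lemma le_TV_iff {n p : ℕ} {V : Fin n → Fin p → EReal} (hVtop : ∀ i k, V i k ≠ ⊤)
    (a : EReal) (b : Fin n → EReal) (i : Fin n) :
    a + b i ≤ TV V b i ↔
      ∀ k, a + (b i + V i k) ≤ ⨆ j ∈ {j : Fin n | j ≠ i}, (V j k + b j) := by
  simp only [TV, le_iInf_iff, Set.mem_ofPred_eq]
  refine forall_congr' fun k => ?_
  by_cases hk : V i k = ⊥
  · simp [hk]
  · obtain ⟨c, hc⟩ : ∃ c : ℝ, (c : EReal) = V i k := ⟨_, EReal.coe_toReal (hVtop i k) hk⟩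
    rw [← hc, ← coe_add_le_iff, add_comm (c : EReal), add_assoc]
    simp

/-- For `λ ∈ [-∞,0]` and `b ∈ (Rmax)^n`, `b ≠ ⊥`, one has
`T(b) ≥ λ + b` if and only if `dist_H(𝒱, H_b) ≤ -λ`, where `𝒱` is the set of
columns of `V` and `T = T_V`. -/
theorem stmt12 {n p : ℕ} (V : Fin n → Fin p → EReal)
    (hVtop : ∀ i k, V i k ≠ ⊤)
    (hrow : ∀ i, ∃ k, V i k ≠ ⊥) (hcol : ∀ k, ∃ i, V i k ≠ ⊥)
    (lam : EReal) (hlam : lam ≤ 0)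
    (b : Fin n → EReal) (hb : IsRmax b) (hbb : b ≠ ⊥) :
    (∀ i, lam + b i ≤ TV V b i) ↔ distHS (cols V) (hyper b) ≤ -lam := by
  induction lam with
  | top => simp at hlam
  | bot => simp
  | coe l =>
    have hl : 0 ≤ -l := neg_nonneg.2 (by exact_mod_cast hlam)
    have hcne : ∀ k, col V k ≠ ⊥ := fun k hk =>
      let ⟨i, hi⟩ := hcol k
      hi (congrFun hk i)
    simp only [le_TV_iff hVtop, distHS, cols, iSup_le_iff, Set.forall_mem_range,
      ← EReal.coe_neg]
    rw [forall_comm]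
    refine forall_congr' fun k => ⟨fun h => ?_, fun h i => ?_⟩
    · exact distPt_le_of_neg_add_le hb hbb (fun i => hVtop i k) (hcne k) hl
        (by simpa only [neg_neg] using h)
    · simpa only [neg_neg, col] using neg_add_le_of_distPt_le (hcne k) h i

end TropReg
end
end

section
/- Suppose that all entries of V ∈ R^{n×p} are real (finite). Then the operator T = T_V admits a finite eigenvector: there exist a ∈ R^n and λ ∈ R such that T(a) = λ + a. -/
open scoped Classical BigOperators

noncomputable section

namespace TropReg

/-- A monotone additively homogeneous self-map of `ι → ℝ` is nonexpansive in the sup norm. -/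
theorem lipschitzWith_one_of_monotone_of_map_add_const {ι : Type*} [Fintype ι]
    {T : (ι → ℝ) → ι → ℝ} (hmono : Monotone T)
    (hadd : ∀ (x : ι → ℝ) (c : ℝ) (i : ι), T (fun j => x j + c) i = T x i + c) :
    LipschitzWith 1 T := by
  have key : ∀ (x y : ι → ℝ) (i : ι), T x i ≤ T y i + dist x y := by
    intro x y i
    rw [← hadd]
    refine hmono (fun j => ?_) i
    have h := dist_le_pi_dist x y j
    rw [Real.dist_eq] at h
    linarith [le_abs_self (x j - y j)]
  refine LipschitzWith.of_dist_le_mul fun x y => ?_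
  rw [NNReal.coe_one, one_mul, dist_pi_le_iff dist_nonneg]
  intro i
  rw [Real.dist_eq, abs_sub_le_iff]
  have h := key y x i
  rw [dist_comm] at h
  constructor <;> linarith [key x y i]

/-- Discounting a nonexpansive map by the factor `1 - ε` produces a fixed point. -/
theorem exists_eq_smul_of_lipschitzWith_one {E : Type*} [NormedAddCommGroup E]
    [NormedSpace ℝ E] [CompleteSpace E] {T : E → E} (hT : LipschitzWith 1 T)
    {ε : ℝ} (h0 : 0 < ε) (h1 : ε ≤ 1) :
    ∃ x, x = (1 - ε) • T x ∧ ε * ‖x‖ ≤ ‖T 0‖ := by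
  have hd : 0 ≤ 1 - ε := by linarith
  have hc : ContractingWith ⟨1 - ε, hd⟩ (fun x => (1 - ε) • T x) := by
    refine ⟨?_, LipschitzWith.of_dist_le_mul fun x y => ?_⟩
    · exact NNReal.coe_lt_coe.1 (sub_lt_self 1 h0)
    · rw [dist_smul₀, Real.norm_of_nonneg hd]
      have h := hT.dist_le_mul x y
      rw [NNReal.coe_one, one_mul] at h
      exact mul_le_mul_of_nonneg_left h hd
  obtain ⟨x, hx⟩ : ∃ x, x = (1 - ε) • T x := ⟨_, hc.fixedPoint_isFixedPt.symm⟩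
  refine ⟨x, hx, ?_⟩
  have h := hT.dist_le_mul x 0
  rw [NNReal.coe_one, one_mul, dist_zero_right, dist_eq_norm] at h
  have h2 : ‖x‖ = (1 - ε) * ‖T x‖ := by
    conv_lhs => rw [hx, norm_smul, Real.norm_of_nonneg hd]
  have h3 : ‖T x‖ ≤ ‖x‖ + ‖T 0‖ := by
    linarith [norm_le_norm_sub_add (T x) (T 0)]
  nlinarith [mul_le_mul_of_nonneg_left h3 hd, mul_nonneg h0.le (norm_nonneg (T 0))]

/-- A monotone additively homogeneous map all of whose off-diagonal dependencies are
bounded below has a finite additive eigenvector. -/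
theorem exists_additive_eigenvector {ι : Type*} [Fintype ι] [Nonempty ι]
    {T : (ι → ℝ) → ι → ℝ} (hmono : Monotone T)
    (hadd : ∀ (x : ι → ℝ) (c : ℝ) (i : ι), T (fun j => x j + c) i = T x i + c)
    {C : ℝ} (hC : ∀ (x : ι → ℝ) (i j : ι), j ≠ i → x j - C ≤ T x i) :
    ∃ (a : ι → ℝ) (lam : ℝ), ∀ i, T a i = lam + a i := by
  have hT := lipschitzWith_one_of_monotone_of_map_add_const hmono hadd
  obtain ⟨o⟩ := ‹Nonempty ι›
  let ε : ℕ → ℝ := fun m => 1 / ((m : ℝ) + 1)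
  have hε0 : ∀ m, 0 < ε m := fun m => Nat.one_div_pos_of_nat
  have hε1 : ∀ m, ε m ≤ 1 := fun m => by
    have := Nat.one_div_le_one_div (α := ℝ) (Nat.zero_le m)
    simpa [ε] using this
  have hεt : Filter.Tendsto ε Filter.atTop (nhds 0) := tendsto_one_div_add_atTop_nhds_zero_nat
  choose x hx hxn using fun m => exists_eq_smul_of_lipschitzWith_one hT (hε0 m) (hε1 m)
  have habs : ∀ m i, |ε m * x m i| ≤ ‖T 0‖ := by
    intro m i
    rw [abs_mul, abs_of_pos (hε0 m)]
    exact (mul_le_mul_of_nonneg_left (norm_le_pi_norm (x m) i) (hε0 m).le).trans (hxn m)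
  have hosc : ∀ m i j, x m j - x m i ≤ ‖T 0‖ + |C| := by
    intro m i j
    by_cases hij : j = i
    · subst hij
      rw [sub_self]
      positivity
    · have h1 : x m i = (1 - ε m) * T (x m) i := congrFun (hx m) i
      have hd : 0 ≤ 1 - ε m := sub_nonneg.2 (hε1 m)
      have h2 := mul_le_mul_of_nonneg_left (hC (x m) i j hij) hd
      have h3 := le_of_abs_le (habs m j)
      have h4 : (1 - ε m) * C ≤ |C| := by
        nlinarith [mul_le_mul_of_nonneg_left (le_abs_self C) hd,
          mul_nonneg (hε0 m).le (abs_nonneg C)]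
      linarith
  let y : ℕ → ι → ℝ := fun m i => x m i + -x m o
  let z : ℕ → (ι → ℝ) × ℝ := fun m => (y m, ε m * x m o)
  have hz : ∀ m, z m ∈ Metric.closedBall (0 : (ι → ℝ) × ℝ) (‖T 0‖ + |C|) := by
    intro m
    rw [mem_closedBall_zero_iff, Prod.norm_def]
    refine max_le ?_ ?_
    · refine (pi_norm_le_iff_of_nonneg (by positivity)).2 fun i => ?_
      rw [Real.norm_eq_abs, abs_le]
      have h1 := hosc m i o
      have h2 := hosc m o i
      constructor <;> simp only [z, y] <;> linarith
    · exact (habs m o).trans (by linarith [abs_nonneg C])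
  obtain ⟨⟨a, lam⟩, -, φ, hφ, hlim⟩ := (isCompact_closedBall _ _).tendsto_subseq hz
  have hya : Filter.Tendsto (fun m => y (φ m)) Filter.atTop (nhds a) :=
    (continuous_fst.tendsto _).comp hlim
  have hlam : Filter.Tendsto (fun m => ε (φ m) * x (φ m) o) Filter.atTop (nhds lam) :=
    (continuous_snd.tendsto _).comp hlim
  refine ⟨a, lam, fun i => ?_⟩
  have hTy : Filter.Tendsto (fun m => T (y (φ m)) i) Filter.atTop (nhds (T a i)) :=
    (((continuous_apply i).comp hT.continuous).tendsto a).comp hya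
  have hyi : Filter.Tendsto (fun m => y (φ m) i) Filter.atTop (nhds (a i)) :=
    ((continuous_apply i).tendsto a).comp hya
  have heq : ∀ m, T (y m) i = ε m * x m o + y m i + ε m * T (y m) i := by
    intro m
    have h1 : x m i = (1 - ε m) * T (x m) i := congrFun (hx m) i
    have h2 : T (y m) i = T (x m) i + -x m o := hadd (x m) (-x m o) i
    simp only [h2, y]
    linear_combination -h1
  have hrhs := (hlam.add hyi).add ((hεt.comp hφ.tendsto_atTop).mul hTy)
  rw [zero_mul, add_zero] at hrhs
  exact tendsto_nhds_unique (hTy.congr fun m => heq (φ m)) hrhs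

/-- On real vectors, the Shapley operator of a real matrix is given by finite minima and
maxima of real numbers. -/
theorem TV_ofReal {n p : ℕ} (V : Fin n → Fin p → ℝ) (x : Fin n → ℝ) (i : Fin n)
    (hp : (Finset.univ : Finset (Fin p)).Nonempty)
    (hn : (Finset.univ.erase i).Nonempty) :
    TV (fun i k => ((V i k : ℝ) : EReal)) (ofReal x) i =
      ((Finset.univ.inf' hp fun k =>
        -V i k + (Finset.univ.erase i).sup' hn fun j => V j k + x j : ℝ) : EReal) := by
  have hmono : Monotone ((↑) : ℝ → EReal) := EReal.coe_strictMono.monotone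
  rw [Finset.apply_inf'_eq_inf'_comp hp (g := Real.toEReal) fun a b => hmono.map_min,
    Finset.inf'_eq_inf, Finset.inf_univ_eq_iInf]
  simp only [TV, ofReal, Set.mem_ofPred_eq, ne_eq, EReal.coe_ne_bot, not_false_eq_true, iInf_pos]
  refine iInf_congr fun k => ?_
  rw [Function.comp_apply, EReal.coe_add, EReal.coe_neg,
    Finset.apply_sup'_eq_sup'_comp hn (g := Real.toEReal) fun a b => hmono.map_max,
    Finset.sup'_eq_sup, Finset.sup_eq_iSup]
  simp

/-- If all entries of `V` are finite (real), then the Shapley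
operator `T = T_V` admits a finite eigenvector: there exist `a ∈ ℝ^n` and `λ ∈ ℝ`
with `T(a) = λ + a`. -/
theorem stmt15 {n p : ℕ} (hn : 2 ≤ n) (hp : 1 ≤ p) (V : Fin n → Fin p → ℝ) :
    ∃ (a : Fin n → ℝ) (lam : ℝ),
      TV (fun i k => ((V i k : ℝ) : EReal)) (ofReal a) =
        fun i => (lam : EReal) + (a i : EReal) := by
  have hp' : (Finset.univ : Finset (Fin p)).Nonempty := ⟨⟨0, hp⟩, Finset.mem_univ _⟩
  have : Nontrivial (Fin n) := Fin.nontrivial_iff_two_le.2 hn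
  have hn' : ∀ i : Fin n, (Finset.univ.erase i).Nonempty := fun i =>
    (exists_ne i).imp fun j hj => Finset.mem_erase.2 ⟨hj, Finset.mem_univ _⟩
  let T : (Fin n → ℝ) → Fin n → ℝ := fun x i => Finset.univ.inf' hp' fun k =>
    -V i k + (Finset.univ.erase i).sup' (hn' i) fun j => V j k + x j
  have hmono : Monotone T := by
    intro x y hxy i
    refine Finset.inf'_mono_fun fun k _ => ?_
    gcongr with j
    exact hxy j
  have hadd : ∀ (x : Fin n → ℝ) (c : ℝ) (i : Fin n), T (fun j => x j + c) i = T x i + c := by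
    intro x c i
    simp only [T, ← add_assoc, ← Finset.sup'_add]
    exact (map_finset_inf' (OrderIso.addRight c) hp' _).symm
  have hC : ∀ (x : Fin n → ℝ) (i j : Fin n), j ≠ i → x j - 2 * ‖V‖ ≤ T x i := by
    intro x i j hij
    refine Finset.le_inf' _ _ fun k _ => ?_
    have h := Finset.le_sup' (fun j => V j k + x j)
      (Finset.mem_erase.2 ⟨hij, Finset.mem_univ j⟩)
    have hV : ∀ l, |V l k| ≤ ‖V‖ := fun l =>
      (norm_le_pi_norm (V l) k).trans (norm_le_pi_norm V l)
    linarith [(abs_le.1 (hV i)).2, (abs_le.1 (hV j)).1]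
  obtain ⟨a, lam, h⟩ := exists_additive_eigenvector hmono hadd hC
  refine ⟨a, lam, funext fun i => ?_⟩
  rw [TV_ofReal V a i hp' (hn' i), ← EReal.coe_add]
  exact congrArg _ (h i)

end TropReg
end
end

section
/- Let a ∈ R^n and r ∈ [0, +∞]. If for every i ∈ [n] there exists k ∈ [p] such that v^{(k)} ∈ S_i(a) and dist_H(v^{(k)}, H_a) ≥ r, then B(−a, r) ⊆ Col(V), and consequently dist_H(𝒱, H_b) ≥ r for every b ∈ (Rmax)^n with b ≠ ⊥. -/
open scoped Classical BigOperators

noncomputable section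

namespace TropReg

/-- Sector `S_i(a)` of the tropical hyperplane with apex `-a`, for `a ∈ ℝ^n`. -/
def sector {n : ℕ} (a : Fin n → ℝ) (i : Fin n) : Set (Fin n → EReal) :=
  { x | IsRmax x ∧ ∀ j, x j + (a j : EReal) ≤ x i + (a i : EReal) }

/-- A point of the sector `S_i(a)` at distance at least `r` from `H_a` has a gap of at least `r`
between its `i`-th and its other coordinates, relative to `a`. -/
theorem gap_of_le_distPt {n : ℕ} {a : Fin n → ℝ} {r : EReal} {x : Fin n → EReal} {i : Fin n}
    (hx : x ∈ sector a i) (hi : x i ≠ ⊥) (hd_le : r ≤ distPt x (hyper (ofReal a)))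
    {j : Fin n} (hj : j ≠ i) : r + (x j + a j) ≤ x i + a i := by
  obtain ⟨hxtop, hsec⟩ := hx
  obtain ⟨l, hl, hmax⟩ := Finset.exists_max_image (Finset.univ.erase i)
    (fun k => x k + (a k : EReal)) ⟨j, by simpa using hj⟩
  have hli : l ≠ i := by simpa using hl
  have hjl : x j + (a j : EReal) ≤ x l + a l := hmax j (by simpa using hj)
  refine (add_le_add_right hjl r).trans ?_
  by_cases hlbot : x l = ⊥
  · simp [hlbot]
  obtain ⟨u, hu⟩ : ∃ u : ℝ, x l = u := ⟨_, (EReal.coe_toReal (hxtop l) hlbot).symm⟩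
  obtain ⟨w, hw⟩ : ∃ w : ℝ, x i = w := ⟨_, (EReal.coe_toReal (hxtop i) hi).symm⟩
  have huw : u + a l ≤ w + a i := by
    have := hsec l
    rw [hu, hw] at this
    exact_mod_cast this
  set z : Fin n → EReal := Function.update x i ((u + a l - a i : ℝ) : EReal) with hz
  have hzi : z i = ((u + a l - a i : ℝ) : EReal) := by simp [hz]
  have hzne : ∀ k, k ≠ i → z k = x k := fun k hk => by simp [hz, hk]
  have hai : ofReal a i + z i = ((u + a l : ℝ) : EReal) := by
    rw [hzi, ofReal, ← EReal.coe_add]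
    congr 1
    ring
  have hal : ofReal a l + z l = ((u + a l : ℝ) : EReal) := by
    rw [hzne l hli, hu, ofReal, ← EReal.coe_add, add_comm]
  have hsup : (⨆ k, ofReal a k + z k) = ((u + a l : ℝ) : EReal) := by
    refine le_antisymm (iSup_le fun k => ?_) (hai ▸ le_iSup (fun k => ofReal a k + z k) i)
    by_cases hk : k = i
    · rw [hk, hai]
    · have := hmax k (by simpa using hk)
      rw [hu, ← EReal.coe_add] at this
      rwa [hzne k hk, ofReal, add_comm]
  have hzH : z ∈ hyper (ofReal a) := by
    refine ⟨fun k => ?_, i, l, hli.symm, hai.trans hsup.symm, hal.trans hsup.symm⟩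
    by_cases hk : k = i
    · rw [hk, hzi]
      exact EReal.coe_ne_top _
    · rw [hzne k hk]
      exact hxtop k
  have hne : ¬ (x = ⊥ ∧ z = ⊥) := fun h => hi (by rw [h.1]; rfl)
  have hdist : hd x z ≤ ((w + a i - (u + a l) : ℝ) : EReal) := by
    rw [hd, if_neg hne]
    refine sInf_le ⟨w + a i - (u + a l), 0, by simp, fun k => ?_, fun k => ?_⟩
    · by_cases hk : k = i
      · rw [hk, hzi, hw, ← EReal.coe_add]
        exact EReal.coe_le_coe_iff.2 (by linarith)
      · simp [hzne k hk]
    · by_cases hk : k = i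
      · rw [hk, hzi, hw, ← EReal.coe_add]
        exact EReal.coe_le_coe_iff.2 (by linarith)
      · rw [hzne k hk]
        exact le_add_of_nonneg_left (EReal.coe_nonneg.2 (by linarith))
  have hr : r ≤ ((w + a i - (u + a l) : ℝ) : EReal) := hd_le.trans ((iInf₂_le z hzH).trans hdist)
  rw [hu, hw, ← EReal.coe_add, ← EReal.coe_add]
  refine (add_le_add_left hr _).trans ?_
  rw [← EReal.coe_add]
  exact EReal.coe_le_coe_iff.2 (by linarith)

/-- A point with a gap of at least `r` between its `i`-th and its other coordinates, relative
to `b`, is at distance at least `r` from `H_b`. -/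
theorem le_distPt_of_gap {n : ℕ} {b : Fin n → EReal} {r : EReal} {x : Fin n → EReal} {i : Fin n}
    (hb : IsRmax b) (hx : IsRmax x) (hbi : b i ≠ ⊥) (hxi : x i ≠ ⊥)
    (hgap : ∀ j, j ≠ i → r + (x j + b j) ≤ x i + b i) : r ≤ distPt x (hyper b) := by
  refine le_iInf₂ fun z ⟨hz, p, q, hpq, hp, hq⟩ => ?_
  obtain ⟨j, hj, hjsup⟩ : ∃ j, j ≠ i ∧ b i + z i ≤ b j + z j := by
    by_cases hpi : p = i
    · exact ⟨q, fun h => hpq (hpi.trans h.symm), hq ▸ le_iSup (fun k => b k + z k) i⟩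
    · exact ⟨p, hpi, hp ▸ le_iSup (fun k => b k + z k) i⟩
  have hne : ¬ (x = ⊥ ∧ z = ⊥) := fun h => hxi (by rw [h.1]; rfl)
  rw [hd, if_neg hne]
  refine le_sInf ?_
  rintro t ⟨lam, mu, rfl, hmu, hlam⟩
  have h₁ := hlam i
  have h₂ := hmu j
  have h₃ := hgap j hj
  have hbi' := hb i
  have hbj' := hb j
  have hxi' := hx i
  have hxj' := hx j
  have hzi' := hz i
  have hzj' := hz j
  generalize b i = bi at *
  generalize b j = bj at *
  generalize x i = xi at *
  generalize x j = xj at *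
  generalize z i = zi at *
  generalize z j = zj at *
  lift bi to ℝ using ⟨hbi', hbi⟩
  lift xi to ℝ using ⟨hxi', hxi⟩
  lift zi to ℝ using ⟨hzi', by rintro rfl; simp at h₁⟩
  have hbj : bj ≠ ⊥ := by
    rintro rfl
    rw [EReal.bot_add, ← EReal.coe_add] at hjsup
    exact EReal.coe_ne_bot _ (le_bot_iff.1 hjsup)
  have hzj : zj ≠ ⊥ := by
    rintro rfl
    rw [EReal.add_bot, ← EReal.coe_add] at hjsup
    exact EReal.coe_ne_bot _ (le_bot_iff.1 hjsup)
  lift bj to ℝ using ⟨hbj', hbj⟩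
  lift zj to ℝ using ⟨hzj', hzj⟩
  lift xj to ℝ using ⟨hxj', by
    rintro rfl
    rw [← EReal.coe_add] at h₂
    exact EReal.coe_ne_bot _ (le_bot_iff.1 h₂)⟩
  induction r with
  | bot => simp
  | top =>
    rw [← EReal.coe_add, ← EReal.coe_add, EReal.top_add_coe] at h₃
    exact absurd (top_le_iff.1 h₃) (EReal.coe_ne_top _)
  | coe r =>
    norm_cast at *
    linarith

/-- The coordinates of a point of the ball `B(-a, r)`, relative to `a`, differ by at most `r`. -/
theorem add_le_of_mem_ball {n : ℕ} {a : Fin n → ℝ} {r : EReal} {y : Fin n → EReal}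
    (hy : y ∈ ball (ofReal fun i => -a i) r) (hr : r ≠ ⊤) (i j : Fin n) :
    y i + a i ≤ r + (y j + a j) := by
  obtain ⟨hytop, hdist⟩ := hy
  have hne : ¬ ((ofReal fun i => -a i) = ⊥ ∧ y = ⊥) :=
    fun h => EReal.coe_ne_bot (-a i) (congrFun h.1 i)
  rw [hd, if_neg hne] at hdist
  have key : ∀ lam mu : ℝ, (∀ k, (mu : EReal) + y k ≤ ofReal (fun i => -a i) k) →
      (∀ k, ofReal (fun i => -a i) k ≤ (lam : EReal) + y k) →
      ∃ s t : ℝ, y i = s ∧ y j = t ∧ (s + a i) - (t + a j) ≤ lam - mu := by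
    intro lam mu hmu hlam
    have hbot : ∀ k, y k ≠ ⊥ := fun k hk => by
      have := hlam k
      simp [hk, ofReal] at this
    have h₁ := hmu i
    have h₂ := hlam j
    obtain ⟨s, hs⟩ : ∃ s : ℝ, y i = s := ⟨_, (EReal.coe_toReal (hytop i) (hbot i)).symm⟩
    obtain ⟨t, ht⟩ : ∃ t : ℝ, y j = t := ⟨_, (EReal.coe_toReal (hytop j) (hbot j)).symm⟩
    rw [hs, ofReal] at h₁
    rw [ht, ofReal] at h₂
    norm_cast at h₁ h₂
    exact ⟨s, t, hs, ht, by linarith⟩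
  obtain ⟨_, ⟨lam, mu, -, hmu, hlam⟩, -⟩ := sInf_lt_iff.1 (hdist.trans_lt (lt_top_iff_ne_top.2 hr))
  obtain ⟨s, t, hs, ht, -⟩ := key lam mu hmu hlam
  have hle : (((s + a i) - (t + a j) : ℝ) : EReal) ≤ r := by
    refine le_trans (le_sInf ?_) hdist
    rintro _ ⟨lam, mu, rfl, hmu, hlam⟩
    obtain ⟨s', t', hs', ht', h⟩ := key lam mu hmu hlam
    obtain rfl : s = s' := EReal.coe_injective (hs.symm.trans hs')
    obtain rfl : t = t' := EReal.coe_injective (ht.symm.trans ht')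
    exact_mod_cast h
  rw [hs, ht]
  refine le_trans (le_of_eq ?_) (add_le_add_left hle _)
  norm_cast
  ring

/-- A point each of whose coordinates is attained by a translated column lying below the point
belongs to the column space. -/
theorem mem_colSpace_of_forall_exists {n p : ℕ} {V : Fin n → Fin p → EReal} {y : Fin n → EReal}
    (h : ∀ i, ∃ k, ∃ c : EReal, c ≠ ⊤ ∧ V i k + c = y i ∧ ∀ j, V j k + c ≤ y j) :
    y ∈ colSpace V := by
  choose K c hc heq hle using h
  have hattain : ∀ k, (⨆ i ∈ {i | K i = k}, c i) = ⊥ ∨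
      ∃ i, K i = k ∧ (⨆ i ∈ {i | K i = k}, c i) = c i := by
    intro k
    by_cases hk : (Finset.univ.filter fun i => K i = k).Nonempty
    · obtain ⟨i, hi, hmax⟩ := Finset.exists_max_image _ c hk
      have hi' : K i = k := by simpa using hi
      exact .inr ⟨i, hi', le_antisymm (iSup₂_le fun l hl => hmax l (by simpa using hl))
        (le_iSup₂ (f := fun i (_ : i ∈ {i | K i = k}) => c i) i hi')⟩
    · refine .inl (le_bot_iff.1 (iSup₂_le fun l hl => (hk ⟨l, by simpa using hl⟩).elim))
  refine ⟨fun k => ⨆ i ∈ {i | K i = k}, c i, fun k => ?_, funext fun j => le_antisymm ?_ ?_⟩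
  · rcases hattain k with h | ⟨i, -, h⟩
    · simp only [h]
      exact bot_ne_top
    · simp only [h]
      exact hc i
  · rw [← heq j]
    refine le_trans (add_le_add_right ?_ _)
      (le_iSup (fun k => V j k + ⨆ i ∈ {i | K i = k}, c i) (K j))
    exact le_iSup₂ (f := fun i (_ : i ∈ {i | K i = K j}) => c i) j rfl
  · refine iSup_le fun k => ?_
    rcases hattain k with h | ⟨i, rfl, h⟩
    · simp only [h, EReal.add_bot, bot_le]
    · simp only [h]
      exact hle i j

/-- If `a ∈ ℝ^n`, `r ∈ [0,+∞]` and each sector `S_i(a)` contains a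
column `v^{(k)}` with `dist_H(v^{(k)}, H_a) ≥ r`, then `B(-a,r) ⊆ Col(V)` and
consequently `dist_H(𝒱, H_b) ≥ r` for every hyperplane `H_b` with `b ≠ ⊥`. -/
theorem stmt16 {n p : ℕ} (V : Fin n → Fin p → EReal)
    (hVtop : ∀ i k, V i k ≠ ⊤)
    (hrow : ∀ i, ∃ k, V i k ≠ ⊥) (hcol : ∀ k, ∃ i, V i k ≠ ⊥)
    (a : Fin n → ℝ) (r : EReal) (hr : 0 ≤ r)
    (h : ∀ i, ∃ k : Fin p, col V k ∈ sector a i ∧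
      r ≤ distPt (col V k) (hyper (ofReal a))) :
    ball (ofReal (fun i => - a i)) r ⊆ colSpace V ∧
    ∀ b : Fin n → EReal, IsRmax b → b ≠ ⊥ → r ≤ distHS (cols V) (hyper b) := by
  choose K hsec hdist using h
  have hbot : ∀ i, V i (K i) ≠ ⊥ := by
    intro i hi
    obtain ⟨j, hj⟩ := hcol (K i)
    have hji := (hsec i).2 j
    simp only [col, hi, EReal.bot_add, le_bot_iff, EReal.add_eq_bot_iff, EReal.coe_ne_bot,
      or_false] at hji
    exact hj hji
  have hgap : ∀ i j, j ≠ i → r + (V j (K i) + a j) ≤ V i (K i) + a i := fun i j hj =>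
    gap_of_le_distPt (hsec i) (hbot i) (hdist i) hj
  refine ⟨fun y hy => mem_colSpace_of_forall_exists fun i => ?_, fun b hb hb0 => ?_⟩
  · obtain ⟨v, hv⟩ : ∃ v : ℝ, V i (K i) = v :=
      ⟨_, (EReal.coe_toReal (hVtop _ _) (hbot i)).symm⟩
    have hyi : y i ≠ ⊤ := hy.1 i
    have hattain : V i (K i) + (y i - v) = y i := by
      rw [hv]
      generalize y i = yi at *
      induction yi
      · simp
      · norm_cast
        ring
      · exact absurd rfl hyi
    refine ⟨K i, y i - v, ?_, hattain, fun j => ?_⟩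
    · generalize y i = yi at *
      induction yi
      · simp
      · exact EReal.coe_ne_top _
      · exact absurd rfl hyi
    by_cases hj : j = i
    · rw [hj, hattain]
    have h₁ := hgap i j hj
    have h₂ := add_le_of_mem_ball (i := i) (j := j) hy
    have hyj : y j ≠ ⊤ := hy.1 j
    have hVj := hVtop j (K i)
    rw [hv] at h₁
    generalize V j (K i) = w at *
    generalize y i = yi at *
    generalize y j = yj at *
    induction w with
    | bot => simp
    | top => exact absurd rfl hVj
    | coe w =>
      induction r with
      | bot => exact absurd hr (by simp)
      | top =>
        rw [← EReal.coe_add, ← EReal.coe_add, EReal.top_add_coe] at h₁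
        exact absurd (top_le_iff.1 h₁) (EReal.coe_ne_top _)
      | coe r =>
        have h₃ := h₂ (EReal.coe_ne_top r)
        induction yi with
        | bot => simp
        | top => exact absurd rfl hyi
        | coe yi =>
          induction yj with
          | bot => simp [← EReal.coe_add] at h₃
          | top => simp
          | coe yj =>
            norm_cast at *
            linarith
  · obtain ⟨l, hl⟩ : ∃ l, b l ≠ ⊥ := by
      by_contra! hall
      exact hb0 (funext hall)
    obtain ⟨i, -, hmax⟩ := Finset.exists_max_image Finset.univ
      (fun k => b k - (a k : EReal)) ⟨l, Finset.mem_univ l⟩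
    have hbi : b i ≠ ⊥ := by
      intro hi
      have hli := hmax l (Finset.mem_univ l)
      have hltop := hb l
      simp only [hi] at hli
      generalize b l = bl at *
      induction bl
      · exact hl rfl
      · rw [EReal.bot_sub, ← EReal.coe_sub] at hli
        exact absurd (le_bot_iff.1 hli) (EReal.coe_ne_bot _)
      · exact hltop rfl
    refine le_trans ?_ (le_iSup₂ (f := fun x (_ : x ∈ cols V) => distPt x (hyper b))
      (col V (K i)) ⟨K i, rfl⟩)
    refine le_distPt_of_gap hb (hsec i).1 hbi (hbot i) fun j hj => ?_
    have h₁ := hgap i j hj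
    have h₂ := hmax j (Finset.mem_univ j)
    have hbi' := hb i
    have hbj' := hb j
    have hVi := hbot i
    have hVi' := hVtop i (K i)
    have hVj' := hVtop j (K i)
    simp only [col] at h₁ h₂ ⊢
    generalize V i (K i) = v at *
    generalize V j (K i) = w at *
    generalize b i = bi at *
    generalize b j = bj at *
    lift bi to ℝ using ⟨hbi', hbi⟩
    lift v to ℝ using ⟨hVi', hVi⟩
    induction w with
    | bot => simp
    | top => exact absurd rfl hVj'
    | coe w =>
      induction bj with
      | bot => simp
      | top => exact absurd rfl hbj'
      | coe bj =>
        induction r with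
        | bot => simp
        | top =>
          rw [← EReal.coe_add, ← EReal.coe_add, EReal.top_add_coe] at h₁
          exact absurd (top_le_iff.1 h₁) (EReal.coe_ne_top _)
        | coe r =>
          norm_cast at *
          linarith

end TropReg
end
end
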